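/- arXiv:2603.15782 — 5 statements merged into one kernel-verified Lean document; each statement's English description precedes it below -/
import Mathlib

section
/- Let G=(V,E) be a finite simple graph with n=|V| vertices, let w:V→ℕ be vertex weights, and let c∈(0,1/2) satisfy c·n ≤ ⌊n/2⌋. Set ξ=(9/4)c². If C⊆V is a c-balanced vertex separator of G, then there exist nonnegative reals (x_i)_{i∈V} and vectors (v_i)_{i∈V} in ℝ^n such that: (i) ‖v_i‖²=1 for all i∈V; (ii) x_i+x_j ≥ ‖v_i−v_j‖² for every edge {i,j}∈E; (iii) for every sequence p_0,…,p_ℓ of pairwise distinct vertices, Σ_{j=1}^{ℓ} ‖v_{p_j}−v_{p_{j−1}}‖² ≥ ‖v_{p_ℓ}−v_{p_0}‖²; (iv) for every S⊆V with |S| ≥ (1−c/4)n, Σ_{i,j∈S, i<j} ‖v_i−v_j‖² ≥ ξn²; and moreover Σ_{i∈V} w(i)·x_i ≤ 4·Σ_{i∈C} w(i). In other words, one quarter of the optimal value of the semidefinite programming relaxation is a lower bound on the minimum size of a c-balanced vertex separator. -/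
/-- A function satisfying the triangle inequality and vanishing on the diagonal is bounded by its
sum along any path. -/
lemma le_sum_path_of_triangle {V : Type*} (d : V → V → ℝ) (hself : ∀ a, d a a = 0)
    (htri : ∀ a b c, d c a ≤ d b a + d c b) :
    ∀ (ℓ : ℕ) (p : Fin (ℓ + 1) → V),
      d (p (Fin.last ℓ)) (p 0) ≤ ∑ j : Fin ℓ, d (p j.succ) (p j.castSucc) := by
  intro ℓ
  induction ℓ with
  | zero => intro p; simp [hself]
  | succ ℓ ih =>
    intro p
    rw [Fin.sum_univ_castSucc]
    have h := ih (fun i => p i.castSucc)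
    have h' := htri (p 0) (p (Fin.last ℓ).castSucc) (p (Fin.last (ℓ + 1)))
    simp only [Fin.castSucc_zero, Fin.succ_castSucc, Fin.succ_last] at h h' ⊢
    linarith

/-- The signed indicator of `P`: `1` on `P` and `-1` off `P`. -/
def signIndicator {V : Type*} [DecidableEq V] (P : Finset V) (i : V) : ℝ :=
  if i ∈ P then 1 else -1

lemma signIndicator_sq {V : Type*} [DecidableEq V] (P : Finset V) (i : V) :
    signIndicator P i ^ 2 = 1 := by
  unfold signIndicator; split_ifs <;> norm_num

lemma signIndicator_sub_sq_triangle {V : Type*} [DecidableEq V] (P : Finset V) (a b c : V) :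
    (signIndicator P c - signIndicator P a) ^ 2 ≤
      (signIndicator P b - signIndicator P a) ^ 2 +
        (signIndicator P c - signIndicator P b) ^ 2 := by
  unfold signIndicator; split_ifs <;> norm_num

lemma sum_signIndicator_sub_sq {V : Type*} [DecidableEq V] (P S : Finset V) :
    ∑ i ∈ S, ∑ j ∈ S, (signIndicator P i - signIndicator P j) ^ 2 =
      8 * ((S ∩ P).card : ℝ) * ((S \ P).card : ℝ) := by
  have h : ∀ i j, (signIndicator P i - signIndicator P j) ^ 2 =
      2 - 2 * (signIndicator P i * signIndicator P j) := fun i j => by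
    linear_combination signIndicator_sq P i + signIndicator_sq P j
  have hsum : ∑ i ∈ S, signIndicator P i = (S ∩ P).card - (S \ P).card := by
    simp only [signIndicator, Finset.sum_ite, Finset.sum_const, Finset.filter_mem_eq_inter,
      Finset.filter_notMem_eq_sdiff, nsmul_eq_mul]
    ring
  have hcard : (S.card : ℝ) = (S ∩ P).card + (S \ P).card := by
    exact_mod_cast (Finset.card_inter_add_card_sdiff S P).symm
  simp only [h, Finset.sum_sub_distrib, Finset.sum_const, nsmul_eq_mul, ← Finset.mul_sum,
    ← Finset.sum_mul, hsum, hcard]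
  ring

lemma norm_smul_sub_smul_sq {E : Type*} [NormedAddCommGroup E] [NormedSpace ℝ E] {e : E}
    (he : ‖e‖ = 1) (a b : ℝ) : ‖a • e - b • e‖ ^ 2 = (a - b) ^ 2 := by
  rw [← sub_smul, norm_smul, he, mul_one, Real.norm_eq_abs, sq_abs]

/-- Disjoint sets `A` and `B`, each of size at most `(1 - c) n`, can be separated by a set `P`
such that both `P` and its complement have size at least `c n`. -/
lemma exists_balanced_separating_finset {V : Type*} [Fintype V] [DecidableEq V] {c : ℝ}
    (hc : c * Fintype.card V ≤ (Fintype.card V / 2 : ℕ)) {A B : Finset V} (hAB : Disjoint A B)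
    (hA : (A.card : ℝ) ≤ (1 - c) * Fintype.card V)
    (hB : (B.card : ℝ) ≤ (1 - c) * Fintype.card V) :
    ∃ P : Finset V, A ⊆ P ∧ Disjoint P B ∧ c * Fintype.card V ≤ P.card ∧
      c * Fintype.card V ≤ Pᶜ.card := by
  have hsub : A ⊆ Bᶜ := Finset.subset_compl_iff_disjoint_right.2 hAB
  have hBc := Finset.card_add_card_compl B
  have hle := Finset.card_le_card hsub
  obtain ⟨k, hAk, hkB, hk, hk'⟩ : ∃ k, A.card ≤ k ∧ k ≤ Bᶜ.card ∧
      c * Fintype.card V ≤ k ∧ (k : ℝ) ≤ (1 - c) * Fintype.card V := by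
    generalize Fintype.card V = n at *
    have hhalf : (2 * (n / 2 : ℕ) : ℝ) ≤ n := by exact_mod_cast Nat.mul_div_le n 2
    have hBc' : (B.card : ℝ) + Bᶜ.card = n := by exact_mod_cast hBc
    rcases le_total (n / 2) A.card with h | h
    · have : ((n / 2 : ℕ) : ℝ) ≤ A.card := by exact_mod_cast h
      exact ⟨A.card, le_rfl, hle, by linarith, hA⟩
    · rcases le_total (n / 2) Bᶜ.card with h' | h'
      · exact ⟨n / 2, h, h', hc, by linarith⟩
      · have : (Bᶜ.card : ℝ) ≤ (n / 2 : ℕ) := by exact_mod_cast h'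
        exact ⟨Bᶜ.card, hle, le_rfl, by linarith, by linarith⟩
  obtain ⟨P, hAP, hPB, rfl⟩ := Finset.exists_subsuperset_card_eq hsub hAk hkB
  refine ⟨P, hAP, Finset.subset_compl_iff_disjoint_right.1 hPB, hk, ?_⟩
  have : (P.card : ℝ) + Pᶜ.card = Fintype.card V := by exact_mod_cast Finset.card_add_card_compl P
  linarith

lemma card_le_card_inter_add {V : Type*} [Fintype V] [DecidableEq V] (P S : Finset V) :
    P.card + S.card ≤ (S ∩ P).card + Fintype.card V := by
  have h := Finset.card_union_add_card_inter S P
  have h' := Finset.card_le_univ (S ∪ P)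
  omega


/-- The SDP relaxation value, divided by 4, lower-bounds the minimum
`c`-balanced vertex separator size: given a `c`-balanced vertex separator `C`,
there is a feasible solution `(x, v)` of the SDP of value at most `4 · w(C)`. -/
theorem sdp_relaxation_lower_bound
    {V : Type*} [Fintype V] [DecidableEq V]
    (G : SimpleGraph V) [DecidableRel G.Adj]
    (n : ℕ) (hn : n = Fintype.card V)
    (w : V → ℕ) (c : ℝ) (hc0 : 0 < c) (hc1 : c < 1/2)
    (hcn : c * n ≤ (n / 2 : ℕ))
    (ξ : ℝ) (hξ : ξ = (9/4) * c^2)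
    (C A B : Finset V)
    (hpart : A ∪ B = Cᶜ) (hAB : Disjoint A B)
    (hsep : ∀ a ∈ A, ∀ b ∈ B, ¬ G.Adj a b)
    (hbalA : (A.card : ℝ) ≤ (1 - c) * n)
    (hbalB : (B.card : ℝ) ≤ (1 - c) * n) :
    ∃ (x : V → ℝ) (v : V → EuclideanSpace ℝ (Fin n)),
      (∀ i, 0 ≤ x i) ∧
      (∀ i, ‖v i‖^2 = 1) ∧
      (∀ i j, G.Adj i j → x i + x j ≥ ‖v i - v j‖^2) ∧
      (∀ (ℓ : ℕ) (p : Fin (ℓ + 1) → V), Function.Injective p →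
        ∑ j : Fin ℓ, ‖v (p j.succ) - v (p j.castSucc)‖^2 ≥ ‖v (p (Fin.last ℓ)) - v (p 0)‖^2) ∧
      (∀ S : Finset V, (1 - c/4) * n ≤ S.card →
        (∑ i ∈ S, ∑ j ∈ S, ‖v i - v j‖^2) / 2 ≥ ξ * n^2) ∧
      ∑ i, (w i : ℝ) * x i ≤ 4 * ∑ i ∈ C, (w i : ℝ) := by
  subst hn hξ
  obtain ⟨P, hAP, hPB, hP, hPc⟩ := exists_balanced_separating_finset hcn hAB hbalA hbalB
  obtain ⟨e, he⟩ : ∃ e : EuclideanSpace ℝ (Fin (Fintype.card V)), V → ‖e‖ = 1 := by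
    rcases isEmpty_or_nonempty V with hV | hV
    · exact ⟨0, fun i => hV.elim i⟩
    · exact ⟨EuclideanSpace.single ⟨0, Fintype.card_pos⟩ 1, fun _ => by simp⟩
  have hdist : ∀ i j, ‖signIndicator P i • e - signIndicator P j • e‖ ^ 2 =
      (signIndicator P i - signIndicator P j) ^ 2 := fun i j => norm_smul_sub_smul_sq (he i) _ _
  have hmem : ∀ i, i ∉ C → i ∈ A ∨ i ∈ B := fun i hi => by
    rwa [← Finset.mem_union, hpart, Finset.mem_compl]
  have hcross : ∀ i j, G.Adj i j → i ∈ P → j ∉ P → i ∈ C ∨ j ∈ C := by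
    intro i j hij hi hj
    by_contra! h
    exact hsep i ((hmem i h.1).resolve_right (Finset.disjoint_left.1 hPB hi))
      j ((hmem j h.2).resolve_left fun hA => hj (hAP hA)) hij
  refine ⟨fun i => if i ∈ C then 4 else 0, fun i => signIndicator P i • e, ?_, ?_, ?_, ?_, ?_, ?_⟩
  · intro i; dsimp only; split_ifs <;> norm_num
  · intro i
    rw [norm_smul, he i, mul_one, Real.norm_eq_abs, sq_abs, signIndicator_sq]
  · intro i j hij
    rw [hdist]
    have h₁ := hcross i j hij
    have h₂ := hcross j i hij.symm
    unfold signIndicator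
    dsimp only
    clear hmem hcross hsep hpart hAP hPB
    split_ifs <;> first | norm_num; done | simp_all
  · intro ℓ p _
    simp only [hdist]
    exact le_sum_path_of_triangle (fun a b => (signIndicator P a - signIndicator P b) ^ 2)
      (fun a => by simp) (signIndicator_sub_sq_triangle P) ℓ p
  · intro S hS
    simp only [hdist]
    rw [sum_signIndicator_sub_sq]
    have h₁ : (P.card : ℝ) + S.card ≤ (S ∩ P).card + Fintype.card V := by
      exact_mod_cast card_le_card_inter_add P S
    have h₂ : (Pᶜ.card : ℝ) + S.card ≤ (S \ P).card + Fintype.card V := by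
      rw [Finset.sdiff_eq_inter_compl]
      exact_mod_cast card_le_card_inter_add Pᶜ S
    have hnonneg : 0 ≤ 3 / 4 * c * Fintype.card V := by positivity
    have := mul_le_mul (show 3 / 4 * c * Fintype.card V ≤ ((S ∩ P).card : ℝ) by linarith)
      (show 3 / 4 * c * Fintype.card V ≤ ((S \ P).card : ℝ) by linarith) hnonneg (by positivity)
    linarith
  · simp [Finset.mul_sum, Finset.sum_ite_mem, mul_comm]
end

section
/- Easy case of the oracle: let n ≥ 1, ξ>0, α>0, γ∈[0,1/2], τ∈[0,ξ/2]. Let V be a finite set with |V|=n, let v:V→ℝ^n and ṽ:V→ℝ^d be vectors satisfying |‖ṽ_i−ṽ_j‖² − ‖v_i−v_j‖²| ≤ γ·(‖ṽ_i−ṽ_j‖² + τ) for all i,j∈V, and let X be the Gram matrix X_{ij}=⟨v_i,v_j⟩ with Tr(X)=n. Let S⊆V be a set with Σ_{i,j∈S, i<j} ‖ṽ_i−ṽ_j‖² < ξn²/4. Define the n×n matrix N = −(α/n)·I + (2α/(ξn²))·K_S. Then: (a) Σ_{i,j∈S, i<j} ‖v_i−v_j‖² ≤ ξn²/2; (b)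 N•X ≤ 0; and (c) the spectral norm of N is at most α/n + 2α/(ξn). -/
open scoped RealInnerProductSpace

/-- The spreading matrix `K_S`: `K_S(i,i) = |S| - 1` for `i ∈ S`, `K_S(i,j) = -1` for
distinct `i, j ∈ S`, and `0` elsewhere. -/
def spreadMat {V : Type*} [DecidableEq V] (S : Finset V) : Matrix V V ℝ :=
  fun a b => if a ∈ S ∧ b ∈ S then (if a = b then (S.card : ℝ) - 1 else -1) else 0

/-- The trace inner product `A • B = Tr(Aᵀ B)`. -/
def mdot {V : Type*} [Fintype V] (A B : Matrix V V ℝ) : ℝ := (A.transpose * B).trace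

theorem spreadMat_apply_eq_sub {V : Type*} [DecidableEq V] (S : Finset V) (a b : V) :
    spreadMat S a b = (if a ∈ S then if a = b then (S.card : ℝ) else 0 else 0) -
      if a ∈ S then if b ∈ S then 1 else 0 else 0 := by
  unfold spreadMat
  by_cases ha : a ∈ S <;> by_cases hb : b ∈ S <;> by_cases hab : a = b <;> simp_all

/-- The pairing of the spreading matrix with an arbitrary matrix. -/
theorem mdot_spreadMat {V : Type*} [Fintype V] [DecidableEq V] (S : Finset V)
    (X : Matrix V V ℝ) :
    mdot (spreadMat S) X = S.card * ∑ i ∈ S, X i i - ∑ i ∈ S, ∑ j ∈ S, X i j := by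
  have h : mdot (spreadMat S) X = ∑ i, ∑ j, spreadMat S i j * X i j := by
    simp only [mdot, Matrix.trace, Matrix.diag, Matrix.mul_apply, Matrix.transpose_apply]
    exact Finset.sum_comm
  rw [h]
  simp [spreadMat_apply_eq_sub, sub_mul, Finset.sum_sub_distrib, ite_mul, Finset.mul_sum]

/-- The spreading matrix paired with a Gram matrix gives the total squared distance over
unordered pairs. -/
theorem mdot_spreadMat_gram {V E : Type*} [Fintype V] [DecidableEq V]
    [NormedAddCommGroup E] [InnerProductSpace ℝ E] (S : Finset V) (v : V → E)
    (X : Matrix V V ℝ) (hX : ∀ i j, X i j = ⟪v i, v j⟫) :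
    mdot (spreadMat S) X = (∑ i ∈ S, ∑ j ∈ S, ‖v i - v j‖ ^ 2) / 2 := by
  rw [mdot_spreadMat]
  simp only [hX, norm_sub_sq_real, real_inner_self_eq_norm_sq, Finset.sum_add_distrib,
    Finset.sum_sub_distrib, Finset.sum_const, nsmul_eq_mul, ← Finset.mul_sum]
  ring

/-- The quadratic form of the spreading matrix. -/
theorem dotProduct_spreadMat_mulVec {V : Type*} [Fintype V] [DecidableEq V] (S : Finset V)
    (u : V → ℝ) :
    u ⬝ᵥ (spreadMat S).mulVec u = S.card * ∑ i ∈ S, u i ^ 2 - (∑ i ∈ S, u i) ^ 2 := by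
  have h : u ⬝ᵥ (spreadMat S).mulVec u = mdot (spreadMat S) (Matrix.vecMulVec u u) := by
    simp only [mdot, Matrix.trace, Matrix.diag, Matrix.mul_apply, Matrix.transpose_apply,
      Matrix.vecMulVec_apply, dotProduct, Matrix.mulVec, Finset.mul_sum]
    rw [Finset.sum_comm]
    exact Finset.sum_congr rfl fun _ _ => Finset.sum_congr rfl fun _ _ => by ring
  rw [h, mdot_spreadMat, sq (∑ i ∈ S, u i), Finset.sum_mul_sum]
  simp only [Matrix.vecMulVec_apply, sq]

theorem dotProduct_spreadMat_mulVec_nonneg {V : Type*} [Fintype V] [DecidableEq V]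
    (S : Finset V) (u : V → ℝ) : 0 ≤ u ⬝ᵥ (spreadMat S).mulVec u := by
  rw [dotProduct_spreadMat_mulVec]
  exact sub_nonneg.mpr sq_sum_le_card_mul_sum_sq

theorem dotProduct_spreadMat_mulVec_le {V : Type*} [Fintype V] [DecidableEq V]
    (S : Finset V) (u : V → ℝ) :
    u ⬝ᵥ (spreadMat S).mulVec u ≤ Fintype.card V * (u ⬝ᵥ u) := by
  rw [dotProduct_spreadMat_mulVec]
  have hsum : ∑ i ∈ S, u i ^ 2 ≤ u ⬝ᵥ u := by
    simp only [dotProduct, ← sq]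
    exact Finset.sum_le_univ_sum_of_nonneg fun i => sq_nonneg _
  have hcard : (S.card : ℝ) ≤ Fintype.card V := by exact_mod_cast S.card_le_univ
  have := mul_le_mul hcard hsum (Finset.sum_nonneg fun i _ => sq_nonneg _) (Nat.cast_nonneg _)
  linarith [sq_nonneg (∑ i ∈ S, u i)]

/-- Easy case of the oracle. If the approximate vectors `ṽ` have small
spread over `S`, then (a) the true spread over `S` is at most `ξn²/2`,
(b) `N = -(α/n)·I + (2α/(ξn²))·K_S` satisfies `N • X ≤ 0` for the Gram matrix `X` of
the true vectors, and (c) the spectral norm of `N` (every eigenvalue in absolute value)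
is at most `α/n + 2α/(ξn)`. Sums over unordered pairs `i < j` of elements of `S` are
written as half of the full double sum. -/
theorem oracle_easy_case
    {V : Type*} [Fintype V] [DecidableEq V] {d : ℕ}
    (n : ℕ) (hn1 : 1 ≤ n) (hnV : Fintype.card V = n)
    (ξ α γ τ : ℝ) (hξ : 0 < ξ) (hα : 0 < α)
    (hγ0 : 0 ≤ γ) (hγ1 : γ ≤ 1/2) (hτ0 : 0 ≤ τ) (hτ1 : τ ≤ ξ/2)
    (v : V → EuclideanSpace ℝ (Fin n)) (vt : V → EuclideanSpace ℝ (Fin d))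
    (happrox : ∀ i j, |‖vt i - vt j‖^2 - ‖v i - v j‖^2| ≤ γ * (‖vt i - vt j‖^2 + τ))
    (X : Matrix V V ℝ) (hXdef : ∀ i j, X i j = ⟪v i, v j⟫)
    (hXtrace : X.trace = n)
    (S : Finset V)
    (hS : (∑ i ∈ S, ∑ j ∈ S, ‖vt i - vt j‖^2) / 2 < ξ * n^2 / 4)
    (N : Matrix V V ℝ)
    (hNdef : N = (-(α / n)) • (1 : Matrix V V ℝ) + (2 * α / (ξ * n^2)) • spreadMat S) :
    (∑ i ∈ S, ∑ j ∈ S, ‖v i - v j‖^2) / 2 ≤ ξ * n^2 / 2 ∧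
    mdot N X ≤ 0 ∧
    (∀ (u : V → ℝ) (μ : ℝ), N.mulVec u = μ • u → u ≠ 0 → |μ| ≤ α / n + 2 * α / (ξ * n)) := by
  have hn : (0 : ℝ) < n := by exact_mod_cast hn1
  have hc : 0 ≤ 2 * α / (ξ * n ^ 2) := by positivity
  have hspread : (∑ i ∈ S, ∑ j ∈ S, ‖v i - v j‖ ^ 2) / 2 ≤ ξ * n ^ 2 / 2 := by
    have hpair : ∀ i j, ‖v i - v j‖ ^ 2 ≤ 3 / 2 * ‖vt i - vt j‖ ^ 2 + ξ / 4 := fun i j => by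
      have h := (abs_le.mp (happrox i j)).1
      have := mul_le_mul_of_nonneg_right hγ1 (add_nonneg (sq_nonneg ‖vt i - vt j‖) hτ0)
      linarith
    have hsum : ∑ i ∈ S, ∑ j ∈ S, ‖v i - v j‖ ^ 2 ≤
        ∑ i ∈ S, ∑ j ∈ S, (3 / 2 * ‖vt i - vt j‖ ^ 2 + ξ / 4) :=
      Finset.sum_le_sum fun i _ => Finset.sum_le_sum fun j _ => hpair i j
    simp only [Finset.sum_add_distrib, ← Finset.mul_sum, Finset.sum_const, nsmul_eq_mul] at hsum
    have hcard : (S.card : ℝ) ≤ n := by exact_mod_cast hnV ▸ S.card_le_univ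
    have hsq : (S.card : ℝ) * (S.card * (ξ / 4)) ≤ n * (n * (ξ / 4)) := by gcongr
    nlinarith
  refine ⟨hspread, ?_, fun u μ hu hu0 => ?_⟩
  · have hN : mdot N X = -(α / n) * X.trace + 2 * α / (ξ * n ^ 2) * mdot (spreadMat S) X := by
      simp [hNdef, mdot, add_mul, Matrix.trace_add]
    rw [hN, hXtrace, mdot_spreadMat_gram S v X hXdef]
    have h := mul_le_mul_of_nonneg_left hspread hc
    have h1 : 2 * α / (ξ * n ^ 2) * (ξ * n ^ 2 / 2) = α := by field_simp
    have h2 : -(α / n) * n = -α := by field_simp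
    linarith
  · have hpos : 0 < u ⬝ᵥ u :=
      lt_of_le_of_ne (Finset.sum_nonneg fun i _ => mul_self_nonneg (u i))
        fun h => hu0 (dotProduct_self_eq_zero.mp h.symm)
    have hquad : μ * (u ⬝ᵥ u) = -(α / n) * (u ⬝ᵥ u) +
        2 * α / (ξ * n ^ 2) * (u ⬝ᵥ (spreadMat S).mulVec u) := by
      rw [← smul_eq_mul μ, ← dotProduct_smul, ← hu, hNdef]
      simp [Matrix.add_mulVec, Matrix.smul_mulVec, dotProduct_add, dotProduct_smul, Matrix.neg_mulVec, neg_smul]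
    have hlow := mul_nonneg hc (dotProduct_spreadMat_mulVec_nonneg S u)
    have hup := mul_le_mul_of_nonneg_left (dotProduct_spreadMat_mulVec_le S u) hc
    have hcn : 2 * α / (ξ * n ^ 2) * (Fintype.card V * (u ⬝ᵥ u)) =
        2 * α / (ξ * n) * (u ⬝ᵥ u) := by
      rw [hnV]; field_simp
    have ha : 0 ≤ α / n := by positivity
    have hb : 0 ≤ 2 * α / (ξ * n) := by positivity
    rw [abs_le]
    constructor <;> refine le_of_mul_le_mul_right ?_ hpos
    · nlinarith [mul_nonneg hb hpos.le]
    · nlinarith [mul_nonneg ha hpos.le]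
end

section
/- Flow-value lower bound for the oracle (key inequality of the early-termination case): let c∈(0,1/2), α>0, β>0, and let C₀>0 with C₀ = c'·n·β for reals c'>0 and integer n ≥ 1. Let A and B be finite disjoint sets with |A| = 2c'n, and suppose each element x∈A∪B has an approximate vector x̃∈ℝ^d with ‖x̃‖² ≤ 4/c and a true vector v_x∈ℝ^N, such that for all x∈A, y∈B: |‖x̃−ỹ‖² − ‖v_x−v_y‖²| ≤ γ·(‖x̃−ỹ‖² + τ), where τ ≤ 2 and γ ≤ α/((32/c + 2τ)·C₀). Let d:A×B→ℝ≥0 satisfy Σ_{y∈B} d_{xy} ≤ β for every x∈A, and Σ_{x∈A,y∈B} d_{xy}·‖x̃−ỹ‖² ≥ 2α. Then Σ_{x∈A,y∈B} d_{xy}·‖v_x−v_y‖² ≥ α. -/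
/-- Flow-value lower bound for the oracle. If the flow values `d_{xy}`
certify `Σ d_{xy}·‖x̃ - ỹ‖² ≥ 2α` for the approximate vectors, row sums are at most
`β`, and the approximation error is small enough, then the true vectors satisfy
`Σ d_{xy}·‖v_x - v_y‖² ≥ α`. -/
theorem flow_value_lower_bound
    {ι : Type*} [DecidableEq ι] {d N : ℕ}
    (c α β γ τ cpr C₀ : ℝ) (n : ℕ)
    (hc0 : 0 < c) (hc1 : c < 1/2) (hα : 0 < α) (hβ : 0 < β)
    (hcpr : 0 < cpr) (hn : 1 ≤ n)
    (hC₀pos : 0 < C₀) (hC₀ : C₀ = cpr * n * β)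
    (A B : Finset ι) (hdisj : Disjoint A B)
    (hAcard : (A.card : ℝ) = 2 * cpr * n)
    (vt : ι → EuclideanSpace ℝ (Fin d)) (v : ι → EuclideanSpace ℝ (Fin N))
    (hnorm : ∀ x ∈ A ∪ B, ‖vt x‖^2 ≤ 4 / c)
    (hτ0 : 0 ≤ τ) (hτ : τ ≤ 2)
    (hγ0 : 0 ≤ γ) (hγ : γ ≤ α / ((32 / c + 2 * τ) * C₀))
    (happrox : ∀ x ∈ A, ∀ y ∈ B,
      |‖vt x - vt y‖^2 - ‖v x - v y‖^2| ≤ γ * (‖vt x - vt y‖^2 + τ))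
    (dd : ι → ι → ℝ)
    (hdd : ∀ x ∈ A, ∀ y ∈ B, 0 ≤ dd x y)
    (hrow : ∀ x ∈ A, ∑ y ∈ B, dd x y ≤ β)
    (htot : ∑ x ∈ A, ∑ y ∈ B, dd x y * ‖vt x - vt y‖^2 ≥ 2 * α) :
    ∑ x ∈ A, ∑ y ∈ B, dd x y * ‖v x - v y‖^2 ≥ α := by
  have hdist : ∀ x ∈ A, ∀ y ∈ B, ‖vt x - vt y‖ ^ 2 ≤ 16 / c := by
    intro x hx y hy
    have h1 := hnorm x (Finset.mem_union_left _ hx)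
    have h2 := hnorm y (Finset.mem_union_right _ hy)
    have h3 := parallelogram_law_with_norm ℝ (vt x) (vt y)
    have h4 : (16 : ℝ) / c = 4 * (4 / c) := by ring
    nlinarith [mul_self_nonneg ‖vt x + vt y‖]
  have hsum : ∑ x ∈ A, ∑ y ∈ B, dd x y ≤ 2 * C₀ := by
    calc ∑ x ∈ A, ∑ y ∈ B, dd x y ≤ ∑ _x ∈ A, β := Finset.sum_le_sum hrow
      _ = 2 * C₀ := by rw [Finset.sum_const, nsmul_eq_mul, hAcard, hC₀]; ring
  have hterm : ∀ x ∈ A, ∀ y ∈ B,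
      dd x y * ‖vt x - vt y‖ ^ 2 - dd x y * (γ * (16 / c + τ)) ≤ dd x y * ‖v x - v y‖ ^ 2 := by
    intro x hx y hy
    rw [← mul_sub]
    refine mul_le_mul_of_nonneg_left ?_ (hdd x hx y hy)
    have h1 := (abs_le.mp (happrox x hx y hy)).2
    have h2 : γ * (‖vt x - vt y‖ ^ 2 + τ) ≤ γ * (16 / c + τ) := by
      gcongr
      exact hdist x hx y hy
    linarith
  have hlower := Finset.sum_le_sum fun x hx => Finset.sum_le_sum (hterm x hx)
  simp only [Finset.sum_sub_distrib, ← Finset.sum_mul] at hlower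
  have herr : (∑ x ∈ A, ∑ y ∈ B, dd x y) * (γ * (16 / c + τ)) ≤ α := by
    calc (∑ x ∈ A, ∑ y ∈ B, dd x y) * (γ * (16 / c + τ))
        ≤ 2 * C₀ * (γ * (16 / c + τ)) := by gcongr
      _ = γ * ((32 / c + 2 * τ) * C₀) := by ring
      _ ≤ α := (le_div_iff₀ (by positivity)).mp hγ
  linarith
end

section
/- Matching counting lemma: let A and B be finite disjoint sets of points in ℝ^d, let β>0, Δ>0, F>0, and let d:A×B→ℝ≥0 satisfy Σ_{y∈B} d_{xy} ≤ β for every x∈A, Σ_{x∈A} d_{xy} ≤ β for every y∈B, and Σ_{x∈A,y∈B} d_{xy} ≥ F. Let M_short = {(x,y)∈A×B : d_{xy}>0 and ‖x−y‖² ≤ Δ}, and let M ⊆ M_short be a maximal matching, i.e., no two pairs in M share an element of A or an element of B, and every pair in M_short shares an element with some pair in M. If |M| ≤ k, then Σ_{x∈A,y∈B} d_{xy}·‖x−y‖² ≥ (F − 2kβ)·Δ. In particular, with F = c'βn and k < c'n/3 one gets Σ_{x∈A,y∈B} d_{xy}·‖x−y‖² ≥ (1/3)·c'βn·Δ. -/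
/-- If every row of `f` in `A` sums to at most `β`, then the rows selected by `r` on `M`,
counted with multiplicity, carry total weight at most `M.card * β`. -/
theorem sum_rows_le_card_mul {α γ ι : Type*} [DecidableEq α] (A : Finset α) (B : Finset γ)
    (M : Finset ι) (r : ι → α) (f : α → γ → ℝ) (β : ℝ) (hr : ∀ p ∈ M, r p ∈ A)
    (hrow : ∀ x ∈ A, ∑ y ∈ B, f x y ≤ β) :
    ∑ x ∈ A, ∑ y ∈ B, ∑ p ∈ M, (if r p = x then f x y else 0) ≤ M.card * β := by
  have h : ∑ x ∈ A, ∑ y ∈ B, ∑ p ∈ M, (if r p = x then f x y else 0)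
      = ∑ p ∈ M, ∑ y ∈ B, f (r p) y := by
    rw [Finset.sum_comm, Finset.sum_comm (s := M)]
    refine Finset.sum_congr rfl fun y _ => ?_
    rw [Finset.sum_comm]
    refine Finset.sum_congr rfl fun p hp => ?_
    rw [Finset.sum_ite_eq, if_pos (hr p hp)]
  rw [h, ← nsmul_eq_mul]
  exact Finset.sum_le_card_nsmul _ _ _ fun p hp => hrow _ (hr p hp)

/-- Matching counting lemma. If the flow `d` between point sets
`A, B ⊆ ℝ^d` has row and column sums at most `β` and total value at least `F`, and a
maximal matching `M` among the short flow-carrying pairs (those with `d_{xy} > 0` and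
`‖x-y‖² ≤ Δ`) has size at most `k`, then `Σ d_{xy}·‖x-y‖² ≥ (F - 2kβ)·Δ`. -/
theorem matching_counting
    {d : ℕ}
    (A B : Finset (EuclideanSpace ℝ (Fin d))) (hdisj : Disjoint A B)
    (β Δ F : ℝ) (hβ : 0 < β) (hΔ : 0 < Δ) (hF : 0 < F)
    (dd : EuclideanSpace ℝ (Fin d) → EuclideanSpace ℝ (Fin d) → ℝ)
    (hdd : ∀ x ∈ A, ∀ y ∈ B, 0 ≤ dd x y)
    (hrow : ∀ x ∈ A, ∑ y ∈ B, dd x y ≤ β)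
    (hcol : ∀ y ∈ B, ∑ x ∈ A, dd x y ≤ β)
    (htot : F ≤ ∑ x ∈ A, ∑ y ∈ B, dd x y)
    (Mshort M : Finset (EuclideanSpace ℝ (Fin d) × EuclideanSpace ℝ (Fin d)))
    (hMshort : ∀ q, q ∈ Mshort ↔
      q.1 ∈ A ∧ q.2 ∈ B ∧ 0 < dd q.1 q.2 ∧ ‖q.1 - q.2‖^2 ≤ Δ)
    (hMsub : M ⊆ Mshort)
    (hmatching : ∀ p ∈ M, ∀ q ∈ M, p ≠ q → p.1 ≠ q.1 ∧ p.2 ≠ q.2)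
    (hmaximal : ∀ q ∈ Mshort, ∃ p ∈ M, p.1 = q.1 ∨ p.2 = q.2)
    (k : ℕ) (hM : M.card ≤ k) :
    ∑ x ∈ A, ∑ y ∈ B, dd x y * ‖x - y‖^2 ≥ (F - 2 * k * β) * Δ := by
  classical
  have hMA : ∀ p ∈ M, p.1 ∈ A := fun p hp => ((hMshort p).1 (hMsub hp)).1
  have hMB : ∀ p ∈ M, p.2 ∈ B := fun p hp => ((hMshort p).1 (hMsub hp)).2.1
  have hpoint : ∀ x ∈ A, ∀ y ∈ B, dd x y * Δ ≤ dd x y * ‖x - y‖ ^ 2 +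
      ((∑ p ∈ M, if p.1 = x then dd x y else 0) +
        ∑ p ∈ M, if p.2 = y then dd x y else 0) * Δ := by
    intro x hx y hy
    have h0 := hdd x hx y hy
    have hnonneg₁ : ∀ p ∈ M, 0 ≤ if p.1 = x then dd x y else 0 := fun p _ => by
      split_ifs <;> simp [h0]
    have hnonneg₂ : ∀ p ∈ M, 0 ≤ if p.2 = y then dd x y else 0 := fun p _ => by
      split_ifs <;> simp [h0]
    have hs₁ := Finset.sum_nonneg hnonneg₁
    have hs₂ := Finset.sum_nonneg hnonneg₂
    have hcost : 0 ≤ dd x y * ‖x - y‖ ^ 2 := by positivity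
    by_cases hq : (x, y) ∈ Mshort
    · have hcover : dd x y ≤ (∑ p ∈ M, if p.1 = x then dd x y else 0) +
          ∑ p ∈ M, if p.2 = y then dd x y else 0 := by
        obtain ⟨p, hp, hpx | hpy⟩ := hmaximal _ hq
        · have h := Finset.single_le_sum hnonneg₁ hp
          rw [if_pos hpx] at h
          linarith
        · have h := Finset.single_le_sum hnonneg₂ hp
          rw [if_pos hpy] at h
          linarith
      linarith [mul_le_mul_of_nonneg_right hcover hΔ.le]
    · have hlong : dd x y * Δ ≤ dd x y * ‖x - y‖ ^ 2 := by
        rcases h0.eq_or_lt with h | h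
        · simp [← h]
        · refine mul_le_mul_of_nonneg_left (le_of_not_ge fun hle => ?_) h0
          exact hq ((hMshort _).2 ⟨hx, hy, h, hle⟩)
      linarith [mul_nonneg (add_nonneg hs₁ hs₂) hΔ.le]
  have hsum := Finset.sum_le_sum fun x hx => Finset.sum_le_sum (hpoint x hx)
  simp only [Finset.sum_add_distrib, ← Finset.sum_mul] at hsum
  have hrows := sum_rows_le_card_mul A B M Prod.fst dd β hMA hrow
  have hcols := sum_rows_le_card_mul B A M Prod.snd (fun y x => dd x y) β hMB hcol
  rw [Finset.sum_comm] at hcols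
  have hk : (M.card : ℝ) * β ≤ k * β := by gcongr
  have hcovered := mul_le_mul_of_nonneg_right
    ((add_le_add hrows hcols).trans (add_le_add hk hk)) hΔ.le
  have hflow := mul_le_mul_of_nonneg_right htot hΔ.le
  linarith
end

section
/- Violating-path transfer under approximate distances: let K ≥ 1 be an integer, let 0 < Δ ≤ 1 with K·Δ ≤ 1, let τ < 2 and 0 ≤ γ ≤ Δ/(20(K+1)). Let p_0, p_1, …, p_ℓ (with 1 ≤ ℓ ≤ K) be points, each point p_j having an approximate vector ṽ_{p_j}∈ℝ^d and a true vector v_{p_j}∈ℝ^N such that |‖ṽ_{p_i}−ṽ_{p_j}‖² − ‖v_{p_i}−v_{p_j}‖²| ≤ γ·(‖ṽ_{p_i}−ṽ_{p_j}‖² + τ) for all i,j. Suppose ‖ṽ_{p_j}−ṽ_{p_{j−1}}‖² ≤ Δ for each j=1,…,ℓ, and that the path is violating for the approximate vectors: Σ_{j=1}^{ℓ} ‖ṽ_{p_j}−ṽ_{p_{j−1}}‖² ≤ ‖ṽ_{p_ℓ}−ṽ_{p_0}‖² − Δ. Then Σ_{j=1}^{ℓ} ‖v_{p_j}−v_{p_{j−1}}‖²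 ≤ ‖v_{p_ℓ}−v_{p_0}‖² − Δ/2. -/
/-- Violating-path transfer under approximate distances. If a path
`p_0, …, p_ℓ` (with `1 ≤ ℓ ≤ K`) has all steps short (`≤ Δ`) and is `Δ`-violating for
the approximate vectors `ṽ`, and the true vectors `v` approximate the `ṽ`-distances
with parameters `γ ≤ Δ/(20(K+1))` and `τ < 2`, then the path is `Δ/2`-violating for
the true vectors. -/
theorem violating_path_transfer
    {d N : ℕ} (K : ℕ) (hK : 1 ≤ K)
    (Δ γ τ : ℝ) (hΔ0 : 0 < Δ) (hΔ1 : Δ ≤ 1) (hKΔ : (K : ℝ) * Δ ≤ 1)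
    (hτ : τ < 2) (hγ0 : 0 ≤ γ) (hγ : γ ≤ Δ / (20 * (K + 1)))
    (ℓ : ℕ) (hℓ1 : 1 ≤ ℓ) (hℓK : ℓ ≤ K)
    (vt : Fin (ℓ + 1) → EuclideanSpace ℝ (Fin d))
    (v : Fin (ℓ + 1) → EuclideanSpace ℝ (Fin N))
    (happrox : ∀ i j, |‖vt i - vt j‖^2 - ‖v i - v j‖^2| ≤ γ * (‖vt i - vt j‖^2 + τ))
    (hstep : ∀ j : Fin ℓ, ‖vt j.succ - vt j.castSucc‖^2 ≤ Δ)
    (hviol : ∑ j : Fin ℓ, ‖vt j.succ - vt j.castSucc‖^2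
        ≤ ‖vt (Fin.last ℓ) - vt 0‖^2 - Δ) :
    ∑ j : Fin ℓ, ‖v j.succ - v j.castSucc‖^2
      ≤ ‖v (Fin.last ℓ) - v 0‖^2 - Δ / 2 := by
  set S := ∑ j : Fin ℓ, ‖vt j.succ - vt j.castSucc‖^2 with hS
  have hS1 : S ≤ 1 := by
    have hSΔ : S ≤ ℓ * Δ := by
      simpa using Finset.sum_le_sum fun j (_ : j ∈ Finset.univ) => hstep j
    have hℓK' : (ℓ : ℝ) ≤ K := by exact_mod_cast hℓK
    nlinarith
  have hsum : ∑ j : Fin ℓ, ‖v j.succ - v j.castSucc‖^2 ≤ S + γ * S + ℓ * (γ * τ) := by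
    have hj : ∀ j ∈ (Finset.univ : Finset (Fin ℓ)), ‖v j.succ - v j.castSucc‖^2 ≤
        ‖vt j.succ - vt j.castSucc‖^2 + γ * ‖vt j.succ - vt j.castSucc‖^2 + γ * τ := by
      intro j _
      linarith [(abs_le.mp (happrox j.succ j.castSucc)).1]
    simpa [Finset.sum_add_distrib, ← Finset.mul_sum, ← hS] using Finset.sum_le_sum hj
  have hend := (abs_le.mp (happrox (Fin.last ℓ) 0)).2
  have hγK : γ * (K + 1) ≤ Δ / 20 := by
    rw [le_div_iff₀ (by positivity)] at hγ
    linarith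
  have hℓγ : (ℓ + 1) * (γ * τ) ≤ 2 * (γ * (K + 1)) := by
    have hℓγK : (ℓ + 1) * γ ≤ (K + 1) * γ := by gcongr
    have hτ2 : (ℓ + 1) * γ * τ ≤ (ℓ + 1) * γ * 2 := by gcongr
    linarith
  have hγ1 : γ ≤ Δ / 20 :=
    le_trans (le_mul_of_one_le_right hγ0 (by linarith [Nat.cast_nonneg (α := ℝ) K])) hγK
  have hgap := mul_le_mul_of_nonneg_left hviol (show 0 ≤ 1 - γ by linarith)
  have hγS : γ * S ≤ γ := mul_le_of_le_one_right hγ0 hS1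
  have hγΔ : γ * Δ ≤ γ := mul_le_of_le_one_right hγ0 hΔ1
  linarith
end
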